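/- arXiv:2110.09680 — 3 statements merged into one kernel-verified Lean document; each statement's English description precedes it below -/
import Mathlib

section
/- Let N, p be natural numbers with p ≤ N, let C be an N×N real symmetric positive definite matrix, and let W be an (N−p)×N real matrix with orthonormal rows (W Wᵀ = I_{N−p}). Then the condition number of the multilevel covariance matrix is no larger than that of the original covariance matrix: κ(W C Wᵀ) ≤ κ(C), where for a symmetric positive definite matrix A the condition number is κ(A) = λ_max(A)/λ_min(A). -/
open Matrix

lemma aux_quad {n : ℕ} {A : Matrix (Fin n) (Fin n) ℝ} (hA : A.IsHermitian) (x : Fin n → ℝ) :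
    ∃ y : Fin n → ℝ, x ⬝ᵥ x = ∑ i, y i ^ 2 ∧
      x ⬝ᵥ (A *ᵥ x) = ∑ i, hA.eigenvalues i * y i ^ 2 := by
  have hs := hA.spectral_theorem
  set U : Matrix (Fin n) (Fin n) ℝ := (hA.eigenvectorUnitary : Matrix (Fin n) (Fin n) ℝ) with hU
  have hUU : U * Uᵀ = 1 := by
    have := Unitary.coe_mul_star_self hA.eigenvectorUnitary
    simpa [star_eq_conjTranspose] using this
  have hs' : A = U * diagonal hA.eigenvalues * Uᵀ := by
    conv_lhs => rw [hs]
    simp [Unitary.conjStarAlgAut_apply, star_eq_conjTranspose, hU]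
  have key : ∀ v : Fin n → ℝ, x ⬝ᵥ (U *ᵥ v) = (Uᵀ *ᵥ x) ⬝ᵥ v := by
    intro v
    rw [dotProduct_mulVec, mulVec_transpose]
  refine ⟨Uᵀ *ᵥ x, ?_, ?_⟩
  · have h1 : x ⬝ᵥ x = x ⬝ᵥ (U *ᵥ (Uᵀ *ᵥ x)) := by
      rw [mulVec_mulVec, hUU, one_mulVec]
    rw [h1, key]
    simp [dotProduct, sq]
  · have h1 : A *ᵥ x = U *ᵥ (diagonal hA.eigenvalues *ᵥ (Uᵀ *ᵥ x)) := by
      rw [mulVec_mulVec, mulVec_mulVec, ← hs']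
    rw [h1, key]
    simp only [dotProduct, mulVec_diagonal]
    exact Finset.sum_congr rfl fun i _ => by ring

lemma aux_eig {n : ℕ} {A : Matrix (Fin n) (Fin n) ℝ} (hA : A.IsHermitian) (i : Fin n) :
    ∃ v : Fin n → ℝ, v ⬝ᵥ v = 1 ∧ v ⬝ᵥ (A *ᵥ v) = hA.eigenvalues i := by
  have h1 : (hA.eigenvectorBasis i).ofLp ⬝ᵥ (hA.eigenvectorBasis i).ofLp = 1 := by
    have := hA.eigenvectorBasis.orthonormal.1 i
    have h2 := real_inner_self_eq_norm_sq (hA.eigenvectorBasis i)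
    rw [this, EuclideanSpace.inner_eq_star_dotProduct] at h2
    simpa using h2
  refine ⟨(hA.eigenvectorBasis i).ofLp, h1, ?_⟩
  rw [hA.mulVec_eigenvectorBasis, dotProduct_smul, h1]
  simp

/-- The condition number (ratio of largest to smallest eigenvalue) of the
multilevel covariance matrix `W * C * Wᵀ` is no larger than that of `C`,
when `C` is symmetric positive definite and `W` has orthonormal rows. -/
theorem multilevel_covariance_condition_number_le
    (N p : ℕ) (hp : p ≤ N)
    (C : Matrix (Fin N) (Fin N) ℝ) (hC : C.PosDef)
    (W : Matrix (Fin (N - p)) (Fin N) ℝ)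
    (hW : W * Wᵀ = (1 : Matrix (Fin (N - p)) (Fin (N - p)) ℝ)) :
    (⨆ i : Fin (N - p),
        (show (W * C * Wᵀ).IsHermitian by
          simpa using isHermitian_mul_mul_conjTranspose W hC.1).eigenvalues i) /
      (⨅ i : Fin (N - p),
        (show (W * C * Wᵀ).IsHermitian by
          simpa using isHermitian_mul_mul_conjTranspose W hC.1).eigenvalues i) ≤
    (⨆ j : Fin N, hC.1.eigenvalues j) / (⨅ j : Fin N, hC.1.eigenvalues j) := by
  generalize_proofs hB
  have hn0 : ∀ j, 0 < hC.1.eigenvalues j := hC.eigenvalues_pos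
  have hbd : ∀ i, (⨅ j : Fin N, hC.1.eigenvalues j) ≤ hB.eigenvalues i ∧
      hB.eigenvalues i ≤ ⨆ j : Fin N, hC.1.eigenvalues j := by
    intro i
    obtain ⟨v, hv, hve⟩ := aux_eig hB i
    obtain ⟨y, hy, hye⟩ := aux_quad hC.1 (Wᵀ *ᵥ v)
    have e1 : (Wᵀ *ᵥ v) ⬝ᵥ (Wᵀ *ᵥ v) = 1 := by
      rw [dotProduct_mulVec, vecMul_transpose, mulVec_mulVec, hW, one_mulVec, hv]
    have e2 : (Wᵀ *ᵥ v) ⬝ᵥ (C *ᵥ (Wᵀ *ᵥ v)) = hB.eigenvalues i := by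
      rw [← hve, mulVec_transpose, ← dotProduct_mulVec, ← mulVec_transpose, mulVec_mulVec,
        mulVec_mulVec, Matrix.mul_assoc]
    rw [e1] at hy
    rw [e2] at hye
    rw [hye]
    constructor
    · calc (⨅ j : Fin N, hC.1.eigenvalues j)
          = ∑ k, (⨅ j : Fin N, hC.1.eigenvalues j) * y k ^ 2 := by
            rw [← Finset.mul_sum, ← hy, mul_one]
        _ ≤ _ := Finset.sum_le_sum fun k _ => mul_le_mul_of_nonneg_right
            (ciInf_le (Set.finite_range _).bddBelow k) (sq_nonneg _)
    · calc _ ≤ ∑ k, (⨆ j : Fin N, hC.1.eigenvalues j) * y k ^ 2 :=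
            Finset.sum_le_sum fun k _ => mul_le_mul_of_nonneg_right
            (le_ciSup (Set.finite_range _).bddAbove k) (sq_nonneg _)
        _ = _ := by rw [← Finset.mul_sum, ← hy, mul_one]
  have hsup : 0 ≤ ⨆ j : Fin N, hC.1.eigenvalues j := Real.iSup_nonneg fun j => (hn0 j).le
  have hinf : 0 ≤ ⨅ j : Fin N, hC.1.eigenvalues j := Real.iInf_nonneg fun j => (hn0 j).le
  rcases isEmpty_or_nonempty (Fin (N - p)) with h | h
  · rw [Real.iSup_of_isEmpty, zero_div]
    exact div_nonneg hsup hinf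
  · have hN : Nonempty (Fin N) := by
      obtain ⟨i⟩ := h
      exact ⟨⟨i.1, by omega⟩⟩
    have hpos : 0 < ⨅ j : Fin N, hC.1.eigenvalues j := by
      obtain ⟨j, hj⟩ := exists_eq_ciInf_of_finite (f := hC.1.eigenvalues)
      rw [← hj]; exact hn0 j
    exact div_le_div₀ hsup (ciSup_le fun i => (hbd i).2) hpos (le_ciInf fun i => (hbd i).1)
end

section
/- Exactness of the multilevel BLUP solve: let C be an N×N real symmetric positive definite matrix, X an N×p real matrix of full column rank, Y ∈ ℝᴺ, and W an (N−p)×N real matrix with orthonormal rows (W Wᵀ = I_{N−p}) satisfying W X = 0. Define γ_W = (W C Wᵀ)⁻¹ W Y, γ* = Wᵀ γ_W, and β* = (Xᵀ X)⁻¹ Xᵀ (Y − C γ*). Then β* equals the generalized least squares estimate β̂ = (Xᵀ C⁻¹ X)⁻¹ Xᵀ C⁻¹ Y and γ* = C⁻¹(Y − X β̂). -/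
open Matrix

/-- Exactness of the multilevel BLUP solve: with `γ_W = (W C Wᵀ)⁻¹ W Y`,
`γ* = Wᵀ γ_W` and `β* = (Xᵀ X)⁻¹ Xᵀ (Y − C γ*)`, one recovers exactly the GLS
estimate `β̂ = (Xᵀ C⁻¹ X)⁻¹ Xᵀ C⁻¹ Y` and `γ* = C⁻¹ (Y − X β̂)`. -/
theorem multilevel_blup_exact
    (N p : ℕ) (hp : p ≤ N)
    (C : Matrix (Fin N) (Fin N) ℝ) (hC : C.PosDef)
    (X : Matrix (Fin N) (Fin p) ℝ) (hX : X.rank = p)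
    (Y : Fin N → ℝ)
    (W : Matrix (Fin (N - p)) (Fin N) ℝ)
    (hW : W * Wᵀ = (1 : Matrix (Fin (N - p)) (Fin (N - p)) ℝ))
    (hWX : W * X = 0) :
    (Xᵀ * X)⁻¹ *ᵥ (Xᵀ *ᵥ (Y - C *ᵥ (Wᵀ *ᵥ ((W * C * Wᵀ)⁻¹ *ᵥ (W *ᵥ Y))))) =
        (Xᵀ * C⁻¹ * X)⁻¹ *ᵥ (Xᵀ *ᵥ (C⁻¹ *ᵥ Y)) ∧
    Wᵀ *ᵥ ((W * C * Wᵀ)⁻¹ *ᵥ (W *ᵥ Y)) =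
        C⁻¹ *ᵥ (Y - X *ᵥ ((Xᵀ * C⁻¹ * X)⁻¹ *ᵥ (Xᵀ *ᵥ (C⁻¹ *ᵥ Y)))) := by
  have hXinj : Function.Injective X.mulVec := by
    have h := LinearMap.finrank_range_add_finrank_ker X.mulVecLin
    have h1 : Module.finrank ℝ (LinearMap.range X.mulVecLin) = p := hX
    rw [h1, Module.finrank_fin_fun] at h
    have h2 : LinearMap.ker X.mulVecLin = ⊥ := Submodule.finrank_eq_zero.mp (by omega)
    exact LinearMap.ker_eq_bot.mp h2
  have hWtinj : Function.Injective Wᵀ.mulVec := by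
    intro a b h
    have h' := congrArg (fun v => W *ᵥ v) h
    simpa [Matrix.mulVec_mulVec, hW] using h'
  have hWsurj : LinearMap.range W.mulVecLin = ⊤ := by
    rw [LinearMap.range_eq_top]
    intro v
    exact ⟨Wᵀ *ᵥ v, by simp [Matrix.mulVec_mulVec, hW]⟩
  have hker : LinearMap.range X.mulVecLin = LinearMap.ker W.mulVecLin := by
    apply Submodule.eq_of_le_of_finrank_eq
    · rintro _ ⟨v, rfl⟩
      simp [Matrix.mulVec_mulVec, hWX]
    · have h := LinearMap.finrank_range_add_finrank_ker W.mulVecLin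
      have h1 : Module.finrank ℝ (LinearMap.range X.mulVecLin) = p := hX
      rw [hWsurj, finrank_top, Module.finrank_fin_fun, Module.finrank_fin_fun] at h
      omega
  have hXtWt : Xᵀ * Wᵀ = 0 := by rw [← Matrix.transpose_mul, hWX, Matrix.transpose_zero]
  have hCu : IsUnit C.det := (Matrix.isUnit_iff_isUnit_det _).mp hC.isUnit
  have hA : (W * C * Wᵀ).PosDef := by
    have := hC.conjTranspose_mul_mul_same (B := Wᵀ) hWtinj
    simpa [Matrix.conjTranspose_eq_transpose_of_trivial] using this
  have hB : (Xᵀ * C⁻¹ * X).PosDef := by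
    have := hC.inv.conjTranspose_mul_mul_same (B := X) hXinj
    simpa [Matrix.conjTranspose_eq_transpose_of_trivial] using this
  have hD : (Xᵀ * X).PosDef := by
    have := (Matrix.PosDef.one (n := Fin N) (R := ℝ)).conjTranspose_mul_mul_same (B := X) hXinj
    simpa [Matrix.conjTranspose_eq_transpose_of_trivial] using this
  have hAu := (Matrix.isUnit_iff_isUnit_det _).mp hA.isUnit
  have hBu := (Matrix.isUnit_iff_isUnit_det _).mp hB.isUnit
  have hDu := (Matrix.isUnit_iff_isUnit_det _).mp hD.isUnit
  set w := (W * C * Wᵀ)⁻¹ *ᵥ (W *ᵥ Y) with hw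
  have hAw : (W * C * Wᵀ) *ᵥ w = W *ᵥ Y := by
    rw [hw, Matrix.mulVec_mulVec, Matrix.mul_nonsing_inv _ hAu, Matrix.one_mulVec]
  have hr : Y - C *ᵥ (Wᵀ *ᵥ w) ∈ LinearMap.ker W.mulVecLin := by
    rw [LinearMap.mem_ker, Matrix.mulVecLin_apply, Matrix.mulVec_sub, ← hAw]
    simp only [Matrix.mulVec_mulVec, Matrix.mul_assoc, sub_self]
  rw [← hker] at hr
  obtain ⟨b, hb⟩ := hr
  rw [Matrix.mulVecLin_apply] at hb
  have hY : Y = X *ᵥ b + C *ᵥ (Wᵀ *ᵥ w) := by rw [hb]; abel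
  have hCY : C⁻¹ *ᵥ Y = C⁻¹ *ᵥ (X *ᵥ b) + Wᵀ *ᵥ w := by
    conv_lhs => rw [hY]
    rw [Matrix.mulVec_add, Matrix.mulVec_mulVec _ C⁻¹ C, Matrix.nonsing_inv_mul _ hCu,
      Matrix.one_mulVec]
  have hbeta : (Xᵀ * C⁻¹ * X)⁻¹ *ᵥ (Xᵀ *ᵥ (C⁻¹ *ᵥ Y)) = b := by
    have : Xᵀ *ᵥ (C⁻¹ *ᵥ Y) = (Xᵀ * C⁻¹ * X) *ᵥ b := by
      rw [hCY, Matrix.mulVec_add, Matrix.mulVec_mulVec _ Xᵀ Wᵀ, hXtWt, Matrix.zero_mulVec, add_zero]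
      simp only [Matrix.mulVec_mulVec, Matrix.mul_assoc]
    rw [this, Matrix.mulVec_mulVec, Matrix.nonsing_inv_mul _ hBu, Matrix.one_mulVec]
  rw [hbeta]
  constructor
  · rw [← hb, Matrix.mulVec_mulVec _ Xᵀ X, Matrix.mulVec_mulVec, Matrix.nonsing_inv_mul _ hDu,
      Matrix.one_mulVec]
  · rw [Matrix.mulVec_sub, hCY]; abel
end

section
/- Let C be an N×N real symmetric positive definite matrix, X an N×p real matrix of full column rank, Y ∈ ℝᴺ, and W an (N−p)×N real matrix with orthonormal rows (W Wᵀ = I_{N−p}) satisfying W X = 0. Then the unique solution (γ, β) of the saddle-point system C γ + X β = Y, Xᵀ γ = 0 satisfies γ = Wᵀ (W C Wᵀ)⁻¹ W Y; that is, the multilevel formulation recovers the saddle-point solution exactly. -/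
open Matrix

/-- The unique solution `(γ, β)` of the saddle-point system `C γ + X β = Y`,
`Xᵀ γ = 0` satisfies `γ = Wᵀ (W C Wᵀ)⁻¹ W Y`: the multilevel formulation
recovers the saddle-point solution exactly. -/
theorem multilevel_recovers_saddle_point_solution
    (N p : ℕ)
    (C : Matrix (Fin N) (Fin N) ℝ) (hC : C.PosDef)
    (X : Matrix (Fin N) (Fin p) ℝ) (hX : X.rank = p)
    (Y : Fin N → ℝ)
    (W : Matrix (Fin (N - p)) (Fin N) ℝ)
    (hW : W * Wᵀ = (1 : Matrix (Fin (N - p)) (Fin (N - p)) ℝ))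
    (hWX : W * X = 0) :
    (∃! γβ : (Fin N → ℝ) × (Fin p → ℝ),
        C *ᵥ γβ.1 + X *ᵥ γβ.2 = Y ∧ Xᵀ *ᵥ γβ.1 = 0) ∧
    ∀ (γ : Fin N → ℝ) (β : Fin p → ℝ),
      C *ᵥ γ + X *ᵥ β = Y → Xᵀ *ᵥ γ = 0 →
      γ = Wᵀ *ᵥ ((W * C * Wᵀ)⁻¹ *ᵥ (W *ᵥ Y)) := by
  have hXinj : ∀ b : Fin p → ℝ, X *ᵥ b = 0 → b = 0 := by
    have h1 := LinearMap.finrank_range_add_finrank_ker X.mulVecLin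
    have h2 : Module.finrank ℝ (LinearMap.range X.mulVecLin) = p := hX
    rw [h2, Module.finrank_fin_fun] at h1
    have h3 : LinearMap.ker X.mulVecLin = ⊥ := by
      apply Submodule.finrank_eq_zero.mp
      omega
    intro b hb
    have : b ∈ LinearMap.ker X.mulVecLin := by simpa using hb
    rw [h3] at this
    simpa using this
  have hCpos : ∀ v : Fin N → ℝ, v ⬝ᵥ (C *ᵥ v) = 0 → v = 0 := by
    intro v hv
    by_contra hne
    have h := hC.dotProduct_mulVec_pos hne
    simp only [star_trivial] at h
    exact absurd hv h.ne'
  have hWinj : ∀ z : Fin (N - p) → ℝ, Wᵀ *ᵥ z = 0 → z = 0 := by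
    intro z hz
    have : W *ᵥ (Wᵀ *ᵥ z) = z := by rw [mulVec_mulVec, hW, one_mulVec]
    rw [← this, hz, mulVec_zero]
  have hXW : Xᵀ * Wᵀ = 0 := by rw [← transpose_mul, hWX, transpose_zero]
  have hker : ∀ g : Fin N → ℝ, Xᵀ *ᵥ g = 0 → ∃ z, Wᵀ *ᵥ z = g := by
    have h1 := LinearMap.finrank_range_add_finrank_ker Xᵀ.mulVecLin
    have h2 : Module.finrank ℝ (LinearMap.range Xᵀ.mulVecLin) = p := by
      have : Xᵀ.rank = p := by rw [rank_transpose, hX]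
      exact this
    rw [h2, Module.finrank_fin_fun] at h1
    have h3 : Module.finrank ℝ (LinearMap.range Wᵀ.mulVecLin) = N - p := by
      rw [LinearMap.finrank_range_of_inj, Module.finrank_fin_fun]
      rw [← LinearMap.ker_eq_bot, LinearMap.ker_eq_bot']
      intro z hz
      exact hWinj z hz
    have hle : LinearMap.range Wᵀ.mulVecLin ≤ LinearMap.ker Xᵀ.mulVecLin := by
      rintro _ ⟨z, rfl⟩
      rw [LinearMap.mem_ker, mulVecLin_apply, mulVecLin_apply, mulVec_mulVec, hXW, zero_mulVec]
    have heq := Submodule.eq_of_le_of_finrank_eq hle (by omega)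
    intro g hg
    have : g ∈ LinearMap.ker Xᵀ.mulVecLin := hg
    rw [← heq] at this
    obtain ⟨z, hz⟩ := this
    exact ⟨z, hz⟩
  have huniq : ∀ (g : Fin N → ℝ) (b : Fin p → ℝ), C *ᵥ g + X *ᵥ b = 0 → Xᵀ *ᵥ g = 0 →
      g = 0 ∧ b = 0 := by
    intro g b h1 h2
    have hg : g = 0 := by
      apply hCpos
      have h3 : g ⬝ᵥ (C *ᵥ g + X *ᵥ b) = 0 := by rw [h1, dotProduct_zero]
      have h4 : g ⬝ᵥ (X *ᵥ b) = 0 := by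
        rw [dotProduct_mulVec, ← mulVec_transpose, h2, zero_dotProduct]
      rwa [dotProduct_add, h4, add_zero] at h3
    refine ⟨hg, hXinj b ?_⟩
    rwa [hg, mulVec_zero, zero_add] at h1
  let T : ((Fin N → ℝ) × (Fin p → ℝ)) →ₗ[ℝ] ((Fin N → ℝ) × (Fin p → ℝ)) :=
    LinearMap.prod (C.mulVecLin.coprod X.mulVecLin)
      (Xᵀ.mulVecLin ∘ₗ LinearMap.fst ℝ _ _)
  have hT : ∀ v, T v = (C *ᵥ v.1 + X *ᵥ v.2, Xᵀ *ᵥ v.1) := fun v => rfl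
  have hTinj : Function.Injective T := by
    rw [← LinearMap.ker_eq_bot, LinearMap.ker_eq_bot']
    intro v hv
    rw [hT, Prod.mk_eq_zero] at hv
    obtain ⟨h1, h2⟩ := huniq v.1 v.2 hv.1 hv.2
    exact Prod.ext h1 h2
  refine ⟨?_, ?_⟩
  · obtain ⟨v, hv⟩ := LinearMap.injective_iff_surjective.mp hTinj (Y, 0)
    refine ⟨v, ?_, ?_⟩
    · rw [hT, Prod.mk.injEq] at hv
      exact hv
    · intro w hw
      apply hTinj
      rw [hv, hT, hw.1, hw.2]
  · intro g b h1 h2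
    obtain ⟨z, rfl⟩ := hker g h2
    have hdet : IsUnit (W * C * Wᵀ).det := by
      rw [← isUnit_iff_isUnit_det, ← mulVec_injective_iff_isUnit]
      have : Function.Injective (W * C * Wᵀ).mulVecLin := by
        rw [← LinearMap.ker_eq_bot, LinearMap.ker_eq_bot']
        intro y hy
        rw [mulVecLin_apply] at hy
        apply hWinj
        apply hCpos
        have h3 : y ⬝ᵥ ((W * C * Wᵀ) *ᵥ y) = 0 := by rw [hy, dotProduct_zero]
        rwa [Matrix.mul_assoc, ← mulVec_mulVec, ← mulVec_mulVec, dotProduct_mulVec,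
          ← mulVec_transpose] at h3
      exact this
    have h3 : W *ᵥ Y = (W * C * Wᵀ) *ᵥ z := by
      rw [← h1, mulVec_add, mulVec_mulVec _ W X, hWX, zero_mulVec, add_zero, mulVec_mulVec,
        mulVec_mulVec, Matrix.mul_assoc]
    rw [h3, mulVec_mulVec _ (W * C * Wᵀ)⁻¹, nonsing_inv_mul _ hdet, one_mulVec]
end
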